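/- Let ℓ ≥ 2. For every 1 ≤ j ≤ ℓ, the derivation φ_j belongs to D(cS(D_ℓ)); that is, for every defining linear form α of the cone over the Shi arrangement of type D_ℓ (namely α = x_s + εx_t − z and α = x_s + εx_t for all 1 ≤ s < t ≤ ℓ and ε ∈ {−1,1}, and α = z), α divides φ_j(α) in S. -/

import Mathlib

open MvPolynomial Finset

noncomputable section

/-- Elementary symmetric function of degree `n` of the values of `f` on the finite set `s`. -/
def esymVal {α R : Type*} [CommSemiring R] (s : Finset α) (f : α → R) (n : ℕ) : R :=
  ∑ t ∈ Finset.powersetCard n s, ∏ a ∈ t, f a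

/-- The characterizing conditions for the family of Bernoulli-like polynomials `B p q`
(for `p ≥ -1`, `q ≥ 0`, `(p,q) ≠ (-1,0)`):  oddness and the (denominator-cleared)
difference equations. -/
def BProp (B : ℤ → ℕ → Polynomial ℝ) : Prop :=
  (∀ (p : ℤ) (q : ℕ), -1 ≤ p → ¬(p = -1 ∧ q = 0) →
      (B p q).comp (-Polynomial.X) = -(B p q)) ∧
  (∀ (p q : ℕ),
      (2 * Polynomial.X + 1) * ((B p q).comp (Polynomial.X + 1) - B p q)
        = ((Polynomial.X + 1) ^ p - (-Polynomial.X) ^ p)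
            * (Polynomial.X + 1) ^ q * (-Polynomial.X) ^ q) ∧
  (∀ q : ℕ, 1 ≤ q →
      (B (-1) q).comp (Polynomial.X + 1) - B (-1) q
        = -((-Polynomial.X) * (Polynomial.X + 1)) ^ (q - 1))

/-- The polynomial ring `S = ℝ[x_1, …, x_ℓ, z]`; the variable indexed by
`Fin.castSucc i` is `x_{i+1}` and the variable indexed by `Fin.last ℓ` is `z`. -/
abbrev SS (ℓ : ℕ) := MvPolynomial (Fin (ℓ + 1)) ℝ

/-- The field of rational functions, in which the defining formulas for the `φ_j` live. -/
abbrev KK (ℓ : ℕ) := FractionRing (SS ℓ)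

/-- `x_{i+1}` as a rational function. -/
def xx (ℓ : ℕ) (i : Fin ℓ) : KK ℓ := algebraMap (SS ℓ) (KK ℓ) (X i.castSucc)

/-- `z` as a rational function. -/
def zz (ℓ : ℕ) : KK ℓ := algebraMap (SS ℓ) (KK ℓ) (X (Fin.last ℓ))

/-- `ar B_{p,q}(x, z) = z^{p+2q}·B_{p,q}(x/z)`, as a rational function; by convention
`ar B_{-1,0}(x,z) = -1/x`. -/
def arB (B : ℤ → ℕ → Polynomial ℝ) (ℓ : ℕ) (p : ℤ) (q : ℕ) (x : KK ℓ) : KK ℓ :=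
  if p = -1 ∧ q = 0 then -x⁻¹
  else zz ℓ ^ (p + 2 * (q : ℤ)) *
    Polynomial.eval₂ ((algebraMap (SS ℓ) (KK ℓ)).comp (MvPolynomial.C)) (x / zz ℓ) (B p q)

/-- `J = {x_1, …, x_{j-1}}` (as a set of indices). -/
def Jset (ℓ : ℕ) (j : Fin ℓ) : Finset (Fin ℓ) := univ.filter (· < j)

/-- The value `φ_j(x_i)` (an element of the fraction field, which is in fact
a polynomial).  Here `j` with `(j:ℕ)+1 < ℓ` encodes `φ_{j+1}`, `1 ≤ j+1 ≤ ℓ-1`,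
and `j = Fin.last` encodes `φ_ℓ`. -/
def phi (B : ℤ → ℕ → Polynomial ℝ) (ℓ : ℕ) (j i : Fin ℓ) : KK ℓ :=
  if h : (j : ℕ) + 1 < ℓ then
    (xx ℓ j - xx ℓ ⟨(j : ℕ) + 1, h⟩ - zz ℓ) *
      ∑ K1 ∈ (Jset ℓ j).powerset, ∑ K2 ∈ ((Jset ℓ j) \ K1).powerset,
        (∏ a ∈ K1, xx ℓ a) * (∏ a ∈ K2, xx ℓ a) ^ 2 * (-zz ℓ) ^ K1.card *
          ∑ n1 ∈ Finset.range 3, ∑ n2 ∈ Finset.range (ℓ - (j : ℕ) - 1),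
            (-1 : KK ℓ) ^ (n1 + n2) *
              esymVal ({j, ⟨(j : ℕ) + 1, h⟩} : Finset (Fin ℓ)) (xx ℓ) n1 *
              esymVal (univ.filter (fun a : Fin ℓ => (j : ℕ) + 1 < (a : ℕ)))
                (fun a => xx ℓ a ^ 2) n2 *
              arB B ℓ ((2 - (n1 : ℤ)) + 2 * ((ℓ : ℤ) - (j : ℤ) - 2 - (n2 : ℤ)) - 1)
                ((j : ℕ) - K1.card - K2.card) (xx ℓ i)
  else
    ∑ K1 ∈ (Jset ℓ j).powerset, ∑ K2 ∈ ((Jset ℓ j) \ K1).powerset,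
      (∏ a ∈ K1, xx ℓ a) * (∏ a ∈ K2, xx ℓ a) ^ 2 * (-zz ℓ) ^ K1.card * (-(xx ℓ j)) *
        arB B ℓ (-1) ((j : ℕ) - K1.card - K2.card) (xx ℓ i)


/-- The defining linear forms of the cone over the Shi arrangement of type `D_ℓ`:
`x_s + εx_t − z` and `x_s + εx_t` for `1 ≤ s < t ≤ ℓ`, `ε ∈ {−1,1}`, together with `z`. -/
def forms (ℓ : ℕ) : Set (SS ℓ) :=
  {f | f = X (Fin.last ℓ) ∨
    ∃ (s t : Fin ℓ) (ε : ℝ), s < t ∧ (ε = 1 ∨ ε = -1) ∧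
      (f = X s.castSucc + C ε * X t.castSucc - X (Fin.last ℓ) ∨
       f = X s.castSucc + C ε * X t.castSucc)}

/-- The formula for `φ_j(x_i)` with the variables `x_1, …, x_ℓ` replaced by rational functions `x`
and the terms `ar B_{p,q}(x_i, z)` replaced by `g p q`. -/
def phiWith (ℓ : ℕ) (x : Fin ℓ → KK ℓ) (j : Fin ℓ) (g : ℤ → ℕ → KK ℓ) : KK ℓ :=
  if h : (j : ℕ) + 1 < ℓ then
    (x j - x ⟨(j : ℕ) + 1, h⟩ - zz ℓ) *
      ∑ K1 ∈ (Jset ℓ j).powerset, ∑ K2 ∈ ((Jset ℓ j) \ K1).powerset,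
        (∏ a ∈ K1, x a) * (∏ a ∈ K2, x a) ^ 2 * (-zz ℓ) ^ K1.card *
          ∑ n1 ∈ Finset.range 3, ∑ n2 ∈ Finset.range (ℓ - (j : ℕ) - 1),
            (-1 : KK ℓ) ^ (n1 + n2) *
              esymVal ({j, ⟨(j : ℕ) + 1, h⟩} : Finset (Fin ℓ)) x n1 *
              esymVal (univ.filter (fun a : Fin ℓ => (j : ℕ) + 1 < (a : ℕ)))
                (fun a => x a ^ 2) n2 *
              g ((2 - (n1 : ℤ)) + 2 * ((ℓ : ℤ) - (j : ℤ) - 2 - (n2 : ℤ)) - 1)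
                ((j : ℕ) - K1.card - K2.card)
  else
    ∑ K1 ∈ (Jset ℓ j).powerset, ∑ K2 ∈ ((Jset ℓ j) \ K1).powerset,
      (∏ a ∈ K1, x a) * (∏ a ∈ K2, x a) ^ 2 * (-zz ℓ) ^ K1.card * (-(x j)) *
        g (-1) ((j : ℕ) - K1.card - K2.card)

/-- The value `φ_j(x_i)` with the variables `x_1, …, x_ℓ` replaced by arbitrary rational functions
`x`, keeping `z`. -/
def phiAt (B : ℤ → ℕ → Polynomial ℝ) (ℓ : ℕ) (x : Fin ℓ → KK ℓ) (j i : Fin ℓ) : KK ℓ :=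
  phiWith ℓ x j fun p q => arB B ℓ p q (x i)

lemma phi_eq_phiAt (B : ℤ → ℕ → Polynomial ℝ) (ℓ : ℕ) (j i : Fin ℓ) :
    phi B ℓ j i = phiAt B ℓ (xx ℓ) j i := rfl

/-! ### Specialization of rational functions -/

/-- `SpecializesTo τ f g` says that the rational function `f` is defined at `τ`, with value `g`. -/
def SpecializesTo {A K F : Type*} [CommRing A] [Field K] [Algebra A K] [Field F] (τ : A →+* F)
    (f : K) (g : F) : Prop :=
  ∃ a b : A, τ b ≠ 0 ∧ f * algebraMap A K b = algebraMap A K a ∧ g * τ b = τ a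

namespace SpecializesTo

variable {A K F ι : Type*} [CommRing A] [Field K] [Algebra A K] [Field F] {τ : A →+* F}

lemma of_algebraMap (a : A) : SpecializesTo τ (algebraMap A K a) (τ a) :=
  ⟨a, 1, by simp, by simp, by simp⟩

lemma add {f f' : K} {g g' : F} (h : SpecializesTo τ f g) (h' : SpecializesTo τ f' g') :
    SpecializesTo τ (f + f') (g + g') := by
  obtain ⟨a, b, hb, h1, h2⟩ := h
  obtain ⟨a', b', hb', h1', h2'⟩ := h'
  refine ⟨a * b' + a' * b, b * b', by simp [hb, hb'], ?_, ?_⟩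
  · simp only [map_add, map_mul, ← h1, ← h1']; ring
  · simp only [map_add, map_mul, ← h2, ← h2']; ring

lemma mul {f f' : K} {g g' : F} (h : SpecializesTo τ f g) (h' : SpecializesTo τ f' g') :
    SpecializesTo τ (f * f') (g * g') := by
  obtain ⟨a, b, hb, h1, h2⟩ := h
  obtain ⟨a', b', hb', h1', h2'⟩ := h'
  refine ⟨a * a', b * b', by simp [hb, hb'], ?_, ?_⟩
  · simp only [map_mul, ← h1, ← h1']; ring
  · simp only [map_mul, ← h2, ← h2']; ring

lemma zero : SpecializesTo τ (0 : K) 0 := by simpa using of_algebraMap (K := K) (τ := τ) 0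

lemma one : SpecializesTo τ (1 : K) 1 := by simpa using of_algebraMap (K := K) (τ := τ) 1

lemma neg {f : K} {g : F} (h : SpecializesTo τ f g) : SpecializesTo τ (-f) (-g) := by
  obtain ⟨a, b, hb, h1, h2⟩ := h
  exact ⟨-a, b, hb, by simp [← h1], by simp [← h2]⟩

lemma sub {f f' : K} {g g' : F} (h : SpecializesTo τ f g) (h' : SpecializesTo τ f' g') :
    SpecializesTo τ (f - f') (g - g') := by
  simpa only [sub_eq_add_neg] using h.add h'.neg

lemma pow {f : K} {g : F} (h : SpecializesTo τ f g) (n : ℕ) : SpecializesTo τ (f ^ n) (g ^ n) := by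
  induction n with
  | zero => simpa using one
  | succ n ih => simpa only [pow_succ] using ih.mul h

lemma sum {s : Finset ι} {f : ι → K} {g : ι → F} (h : ∀ i ∈ s, SpecializesTo τ (f i) (g i)) :
    SpecializesTo τ (∑ i ∈ s, f i) (∑ i ∈ s, g i) := by
  classical
  induction s using Finset.induction_on with
  | empty => simpa using zero
  | insert a s ha ih =>
    rw [Finset.sum_insert ha, Finset.sum_insert ha]
    exact (h a (by simp)).add (ih fun i hi => h i (by simp [hi]))

lemma prod {s : Finset ι} {f : ι → K} {g : ι → F} (h : ∀ i ∈ s, SpecializesTo τ (f i) (g i)) :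
    SpecializesTo τ (∏ i ∈ s, f i) (∏ i ∈ s, g i) := by
  classical
  induction s using Finset.induction_on with
  | empty => simpa using one
  | insert a s ha ih =>
    rw [Finset.prod_insert ha, Finset.prod_insert ha]
    exact (h a (by simp)).mul (ih fun i hi => h i (by simp [hi]))

lemma esymVal {s : Finset ι} {f : ι → K} {g : ι → F} (h : ∀ i, SpecializesTo τ (f i) (g i)) (n : ℕ) :
    SpecializesTo τ (esymVal s f n) (_root_.esymVal s g n) :=
  sum fun _ _ => prod fun i _ => h i

variable [FaithfulSMul A K]

lemma inv {f : K} {g : F} (h : SpecializesTo τ f g) (hg : g ≠ 0) : SpecializesTo τ f⁻¹ g⁻¹ := by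
  obtain ⟨a, b, hb, h1, h2⟩ := h
  have ha : τ a ≠ 0 := by rw [← h2]; exact mul_ne_zero hg hb
  have ha' : algebraMap A K a ≠ 0 := fun h0 =>
    ha (by rw [(map_eq_zero_iff _ (FaithfulSMul.algebraMap_injective A K)).1 h0, map_zero])
  have hf : f ≠ 0 := by rintro rfl; simp [← h1] at ha'
  exact ⟨b, a, ha, by rw [← h1]; field_simp, by rw [← h2]; field_simp⟩

lemma zpow {f : K} {g : F} (h : SpecializesTo τ f g) (hg : g ≠ 0) (n : ℤ) :
    SpecializesTo τ (f ^ n) (g ^ n) := by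
  cases n with
  | ofNat n => simpa using h.pow n
  | negSucc n => simpa only [zpow_negSucc] using (h.pow (n + 1)).inv (pow_ne_zero _ hg)

lemma apply_eq {p : A} {g : F} (h : SpecializesTo τ (algebraMap A K p) g) : g = τ p := by
  obtain ⟨a, b, hb, h1, h2⟩ := h
  rw [← map_mul] at h1
  rw [← FaithfulSMul.algebraMap_injective A K h1, map_mul] at h2
  exact mul_right_cancel₀ hb h2

end SpecializesTo

lemma zz_ne_zero (ℓ : ℕ) : zz ℓ ≠ 0 := by
  rw [zz, Ne, map_eq_zero_iff _ (FaithfulSMul.algebraMap_injective (SS ℓ) (KK ℓ))]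
  exact MvPolynomial.X_ne_zero _

lemma SpecializesTo.arB {B : ℤ → ℕ → Polynomial ℝ} {ℓ : ℕ} {τ : SS ℓ →+* KK ℓ}
    (hC : ∀ r, τ (C r) = algebraMap (SS ℓ) (KK ℓ) (C r)) (hz : τ (X (Fin.last ℓ)) = zz ℓ)
    (p : ℤ) (q : ℕ) {x y : KK ℓ} (h : SpecializesTo τ x y) (hy : y ≠ 0) :
    SpecializesTo τ (arB B ℓ p q x) (_root_.arB B ℓ p q y) := by
  have hzz : SpecializesTo τ (zz ℓ) (zz ℓ) := by
    have := SpecializesTo.of_algebraMap (K := KK ℓ) (τ := τ) (X (Fin.last ℓ))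
    rwa [hz] at this
  unfold _root_.arB
  split_ifs
  · exact (h.inv hy).neg
  · refine (hzz.zpow (zz_ne_zero ℓ) _).mul ?_
    simp only [Polynomial.eval₂_eq_sum_range, div_eq_mul_inv]
    refine SpecializesTo.sum fun i _ => SpecializesTo.mul ?_ ((h.mul (hzz.inv (zz_ne_zero ℓ))).pow i)
    have := SpecializesTo.of_algebraMap (K := KK ℓ) (τ := τ) (C ((B p q).coeff i))
    rwa [hC] at this

lemma SpecializesTo.phiAt {B : ℤ → ℕ → Polynomial ℝ} {ℓ : ℕ} {τ : SS ℓ →+* KK ℓ}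
    (hC : ∀ r, τ (C r) = algebraMap (SS ℓ) (KK ℓ) (C r)) (hz : τ (X (Fin.last ℓ)) = zz ℓ)
    {x y : Fin ℓ → KK ℓ} (h : ∀ i, SpecializesTo τ (x i) (y i)) (hy : ∀ i, y i ≠ 0) (j i : Fin ℓ) :
    SpecializesTo τ (phiAt B ℓ x j i) (_root_.phiAt B ℓ y j i) := by
  have hzz : SpecializesTo τ (zz ℓ) (zz ℓ) := by
    have := SpecializesTo.of_algebraMap (K := KK ℓ) (τ := τ) (X (Fin.last ℓ))
    rwa [hz] at this
  have hK (K1 K2 : Finset (Fin ℓ)) :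
      SpecializesTo τ ((∏ a ∈ K1, x a) * (∏ a ∈ K2, x a) ^ 2 * (-zz ℓ) ^ K1.card)
        ((∏ a ∈ K1, y a) * (∏ a ∈ K2, y a) ^ 2 * (-zz ℓ) ^ K1.card) :=
    ((prod fun a _ => h a).mul ((prod fun a _ => h a).pow 2)).mul (hzz.neg.pow _)
  unfold _root_.phiAt phiWith
  split_ifs with hj
  · refine (((h _).sub (h _)).sub hzz).mul (sum fun K1 _ => sum fun K2 _ => (hK K1 K2).mul
      (sum fun n1 _ => sum fun n2 _ => SpecializesTo.mul (SpecializesTo.mul (SpecializesTo.mul ?_ ?_) ?_)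
        ((h i).arB hC hz _ _ (hy i))))
    · exact one.neg.pow _
    · exact SpecializesTo.esymVal h n1
    · exact SpecializesTo.esymVal (fun a => (h a).pow 2) n2
  · exact sum fun K1 _ => sum fun K2 _ =>
      ((hK K1 K2).mul (h _).neg).mul ((h i).arB hC hz _ _ (hy i))

/-! ### Functional equations of the homogenized polynomials -/

lemma arB_neg {B : ℤ → ℕ → Polynomial ℝ} (hB : BProp B) (ℓ : ℕ) {p : ℤ} (hp : -1 ≤ p) (q : ℕ)
    (x : KK ℓ) : arB B ℓ p q (-x) = -arB B ℓ p q x := by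
  unfold arB
  split_ifs with h
  · simp [inv_neg]
  · have := congrArg (Polynomial.eval₂ ((algebraMap (SS ℓ) (KK ℓ)).comp MvPolynomial.C) (x / zz ℓ))
      (hB.1 p q hp h)
    rw [Polynomial.eval₂_comp] at this
    simp only [Polynomial.eval₂_neg, Polynomial.eval₂_X] at this
    rw [neg_div, this, mul_neg]

lemma arB_add_arB {B : ℤ → ℕ → Polynomial ℝ} (hB : BProp B) (ℓ : ℕ) {p : ℤ} (hp : -1 ≤ p) (q : ℕ)
    {u v : KK ℓ} (huv : u + v = zz ℓ) (hu : u ≠ 0) (hv : v ≠ 0) (hne : u - v ≠ 0) :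
    arB B ℓ p q u + arB B ℓ p q v = zz ℓ / (u - v) * (u ^ p - v ^ p) * (u * v) ^ q := by
  have hz := zz_ne_zero ℓ
  by_cases h : p = -1 ∧ q = 0
  · obtain ⟨rfl, rfl⟩ := h
    simp only [arB, zpow_neg_one, ← huv]
    field_simp
    simp only [and_self, if_true]
    field_simp
    ring
  have hodd := arB_neg hB ℓ hp q (-v)
  rw [neg_neg] at hodd
  rw [hodd]
  have h1 : -v / zz ℓ + 1 = u / zz ℓ := by rw [← huv] at hz ⊢; field_simp; ring
  simp only [arB, if_neg h]
  set c := (algebraMap (SS ℓ) (KK ℓ)).comp MvPolynomial.C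
  rcases (show p = -1 ∨ 0 ≤ p by omega) with rfl | hp0
  · obtain ⟨q, rfl⟩ : ∃ k, q = k + 1 := ⟨q - 1, by omega⟩
    have := congrArg (Polynomial.eval₂ c (-v / zz ℓ)) (hB.2.2 (q + 1) (by omega))
    simp only [Polynomial.eval₂_comp, Polynomial.eval₂_sub, Polynomial.eval₂_neg,
      Polynomial.eval₂_pow, Polynomial.eval₂_mul, Polynomial.eval₂_add, Polynomial.eval₂_X,
      Polynomial.eval₂_one, h1, add_tsub_cancel_right] at this
    rw [← sub_eq_add_neg, ← mul_sub, this,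
      show (-1 + 2 * ((q + 1 : ℕ) : ℤ)) = ((2 * q + 1 : ℕ) : ℤ) by push_cast; ring, zpow_natCast,
      zpow_neg_one, zpow_neg_one]
    have e : -(-v / zz ℓ) * (u / zz ℓ) = u * v / zz ℓ ^ 2 := by field_simp
    rw [e, div_pow]
    field_simp
    ring
  · lift p to ℕ using hp0
    have := congrArg (Polynomial.eval₂ c (-v / zz ℓ)) (hB.2.1 p q)
    simp only [Polynomial.eval₂_comp, Polynomial.eval₂_sub, Polynomial.eval₂_neg,
      Polynomial.eval₂_pow, Polynomial.eval₂_mul, Polynomial.eval₂_add, Polynomial.eval₂_X,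
      Polynomial.eval₂_one, Polynomial.eval₂_ofNat, h1] at this
    have h2 : 2 * (-v / zz ℓ) + 1 = (u - v) / zz ℓ := by rw [← huv] at hz ⊢; field_simp; ring
    have h3 : -(-v / zz ℓ) = v / zz ℓ := by ring
    rw [h2, h3] at this
    rw [← sub_eq_add_neg, ← mul_sub,
      show ((p : ℤ) + 2 * (q : ℤ)) = ((p + 2 * q : ℕ) : ℤ) by push_cast; ring, zpow_natCast,
      zpow_natCast, zpow_natCast]
    set E := Polynomial.eval₂ c (u / zz ℓ) (B p q) - Polynomial.eval₂ c (-v / zz ℓ) (B p q)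
    have h4 : E = zz ℓ / (u - v) * (((u / zz ℓ) ^ p - (v / zz ℓ) ^ p) * (u / zz ℓ) ^ q *
        (v / zz ℓ) ^ q) := by rw [← this]; field_simp
    rw [h4]
    simp only [div_pow]
    field_simp
    ring

/-! ### Product formulas -/

lemma sum_esymVal_mul_pow {α R : Type*} [CommRing R] (s : Finset α) (f : α → R) (y : R) :
    ∑ n ∈ Finset.range (s.card + 1), (-1) ^ n * esymVal s f n * y ^ (s.card - n) =
      ∏ a ∈ s, (y - f a) := by
  classical
  have : ∏ a ∈ s, (y - f a) = ∏ a ∈ s, (-f a + y) := Finset.prod_congr rfl fun a _ => by ring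
  rw [this, Finset.prod_add, Finset.sum_powerset]
  refine Finset.sum_congr rfl fun n _ => ?_
  rw [esymVal, Finset.mul_sum, Finset.sum_mul]
  refine Finset.sum_congr rfl fun t ht => ?_
  rw [Finset.mem_powersetCard] at ht
  rw [Finset.prod_neg, Finset.prod_const, Finset.card_sdiff_of_subset ht.1, ht.2]

lemma sum_powerset_sum_powerset_sdiff {α R : Type*} [DecidableEq α] [CommRing R] (J : Finset α)
    (x : α → R) (z w : R) :
    ∑ K1 ∈ J.powerset, ∑ K2 ∈ (J \ K1).powerset,
      (∏ a ∈ K1, x a) * (∏ a ∈ K2, x a) ^ 2 * (-z) ^ K1.card * w ^ (J.card - K1.card - K2.card) =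
      ∏ a ∈ J, (-z * x a + (x a ^ 2 + w)) := by
  rw [Finset.prod_add]
  refine Finset.sum_congr rfl fun K1 h1 => ?_
  rw [Finset.prod_add, Finset.mul_sum]
  refine Finset.sum_congr rfl fun K2 h2 => ?_
  rw [Finset.mem_powerset] at h1 h2
  rw [Finset.prod_mul_distrib, Finset.prod_const, Finset.prod_const, Finset.prod_pow,
    Finset.card_sdiff_of_subset h2, Finset.card_sdiff_of_subset h1]
  ring

lemma card_Jset (ℓ : ℕ) (j : Fin ℓ) : (Jset ℓ j).card = j := by
  rw [Jset, show univ.filter (· < j) = Finset.Iio j by ext; simp, Fin.card_Iio]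

lemma card_filter_succ_lt {ℓ : ℕ} {j : Fin ℓ} (h : (j : ℕ) + 1 < ℓ) :
    (univ.filter fun a : Fin ℓ => (j : ℕ) + 1 < (a : ℕ)).card = ℓ - j - 2 := by
  have : (univ.filter fun a : Fin ℓ => (j : ℕ) + 1 < (a : ℕ)) = Finset.Ioi ⟨(j : ℕ) + 1, h⟩ := by
    ext a; simp [Fin.lt_def]
  rw [this, Fin.card_Ioi]
  simp only
  omega

/-- The product over `J_1` and `J_2` of the linear factors in `u` and the quadratic factors in
`u²`. -/
lemma sum_range_three_esymVal {K : Type*} [Field K] {ℓ : ℕ} {j : Fin ℓ} (h : (j : ℕ) + 1 < ℓ)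
    (x : Fin ℓ → K) {u : K} (hu : u ≠ 0) :
    ∑ n1 ∈ Finset.range 3, ∑ n2 ∈ Finset.range (ℓ - (j : ℕ) - 1),
      (-1 : K) ^ (n1 + n2) * esymVal ({j, ⟨(j : ℕ) + 1, h⟩} : Finset (Fin ℓ)) x n1 *
        esymVal (univ.filter (fun a : Fin ℓ => (j : ℕ) + 1 < (a : ℕ))) (fun a => x a ^ 2) n2 *
        u ^ ((2 - (n1 : ℤ)) + 2 * ((ℓ : ℤ) - (j : ℤ) - 2 - (n2 : ℤ)) - 1) =
      u⁻¹ * ((u - x j) * (u - x ⟨(j : ℕ) + 1, h⟩)) *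
        ∏ a ∈ univ.filter (fun a : Fin ℓ => (j : ℕ) + 1 < (a : ℕ)), (u ^ 2 - x a ^ 2) := by
  have hne : j ≠ ⟨(j : ℕ) + 1, h⟩ := fun h' => by simpa using congrArg Fin.val h'
  have h2 : ({j, ⟨(j : ℕ) + 1, h⟩} : Finset (Fin ℓ)).card = 2 := Finset.card_pair hne
  rw [← Finset.prod_pair (f := fun a => u - x a) hne, ← sum_esymVal_mul_pow,
    ← sum_esymVal_mul_pow, h2, card_filter_succ_lt h,
    show ℓ - (j : ℕ) - 2 + 1 = ℓ - j - 1 by omega, mul_assoc, Finset.sum_mul_sum]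
  simp only [Finset.mul_sum]
  refine Finset.sum_congr rfl fun n1 hn1 => Finset.sum_congr rfl fun n2 hn2 => ?_
  rw [Finset.mem_range] at hn1 hn2
  have : (2 - (n1 : ℤ)) + 2 * ((ℓ : ℤ) - (j : ℤ) - 2 - (n2 : ℤ)) - 1 =
      ((2 - n1 + 2 * (ℓ - j - 2 - n2) : ℕ) : ℤ) + -1 := by omega
  rw [this, zpow_add₀ hu, zpow_natCast, zpow_neg_one, pow_add, pow_add, pow_mul]
  ring

lemma sum_Jset_eq_prod {K : Type*} [Field K] {ℓ : ℕ} (j : Fin ℓ) (x : Fin ℓ → K) (u v : K) :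
    ∑ K1 ∈ (Jset ℓ j).powerset, ∑ K2 ∈ ((Jset ℓ j) \ K1).powerset,
      (∏ a ∈ K1, x a) * (∏ a ∈ K2, x a) ^ 2 * (-(u + v)) ^ K1.card *
        (u * v) ^ ((j : ℕ) - K1.card - K2.card) =
      ∏ a ∈ Jset ℓ j, ((x a - u) * (x a - v)) := by
  have := sum_powerset_sum_powerset_sdiff (Jset ℓ j) x (u + v) (u * v)
  rw [card_Jset] at this
  rw [this]
  exact Finset.prod_congr rfl fun a _ => by ring

/-! ### Vanishing on the hyperplanes -/

lemma phiWith_add (ℓ : ℕ) (x : Fin ℓ → KK ℓ) (j : Fin ℓ) (f g : ℤ → ℕ → KK ℓ) :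
    phiWith ℓ x j f + phiWith ℓ x j g = phiWith ℓ x j fun p q => f p q + g p q := by
  unfold phiWith
  split_ifs <;> simp only [← mul_add, ← Finset.sum_add_distrib]

lemma phiWith_neg (ℓ : ℕ) (x : Fin ℓ → KK ℓ) (j : Fin ℓ) (f : ℤ → ℕ → KK ℓ) :
    -phiWith ℓ x j f = phiWith ℓ x j fun p q => -f p q := by
  unfold phiWith
  split_ifs <;> simp only [← mul_neg, ← Finset.sum_neg_distrib]

lemma phiWith_congr {ℓ : ℕ} {x : Fin ℓ → KK ℓ} {j : Fin ℓ} {f g : ℤ → ℕ → KK ℓ}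
    (h : ∀ p q, -1 ≤ p → f p q = g p q) : phiWith ℓ x j f = phiWith ℓ x j g := by
  unfold phiWith
  split_ifs with hj
  · congr 1
    refine Finset.sum_congr rfl fun K1 _ => Finset.sum_congr rfl fun K2 _ => ?_
    congr 1
    refine Finset.sum_congr rfl fun n1 h1 => Finset.sum_congr rfl fun n2 h2 => ?_
    rw [Finset.mem_range] at h1 h2
    rw [h _ _ (by omega)]
  · exact Finset.sum_congr rfl fun K1 _ => Finset.sum_congr rfl fun K2 _ => by rw [h _ _ le_rfl]

/-- The vanishing of `φ_j` on `x_s + ε x_t = z`, where `u = x_s` and `v = ε x_t`. -/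
lemma phiWith_eq_zero {ℓ : ℕ} {x : Fin ℓ → KK ℓ} {s t j : Fin ℓ} (hst : s < t) {ε : KK ℓ}
    (hε : ε = 1 ∨ ε = -1) {u v : KK ℓ} (hus : u = x s) (hvt : v = ε * x t) (huv : u + v = zz ℓ)
    (hu : u ≠ 0) (hv : v ≠ 0) :
    phiWith ℓ x j (fun p q => zz ℓ / (u - v) * (u ^ p - v ^ p) * (u * v) ^ q) = 0 := by
  have hJ : s < j → ∏ a ∈ Jset ℓ j, ((x a - u) * (x a - v)) = 0 := fun hs =>
    Finset.prod_eq_zero (i := s) (by simp [Jset, hs]) (by simp [hus])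
  unfold phiWith
  split_ifs with h
  · have key : ∑ K1 ∈ (Jset ℓ j).powerset, ∑ K2 ∈ ((Jset ℓ j) \ K1).powerset,
        (∏ a ∈ K1, x a) * (∏ a ∈ K2, x a) ^ 2 * (-zz ℓ) ^ K1.card *
          ∑ n1 ∈ Finset.range 3, ∑ n2 ∈ Finset.range (ℓ - (j : ℕ) - 1),
            (-1 : KK ℓ) ^ (n1 + n2) *
              esymVal ({j, ⟨(j : ℕ) + 1, h⟩} : Finset (Fin ℓ)) x n1 *
              esymVal (univ.filter (fun a : Fin ℓ => (j : ℕ) + 1 < (a : ℕ)))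
                (fun a => x a ^ 2) n2 *
              (zz ℓ / (u - v) *
                (u ^ ((2 - (n1 : ℤ)) + 2 * ((ℓ : ℤ) - (j : ℤ) - 2 - (n2 : ℤ)) - 1) -
                v ^ ((2 - (n1 : ℤ)) + 2 * ((ℓ : ℤ) - (j : ℤ) - 2 - (n2 : ℤ)) - 1)) *
                (u * v) ^ ((j : ℕ) - K1.card - K2.card)) =
        zz ℓ / (u - v) * (∏ a ∈ Jset ℓ j, ((x a - u) * (x a - v))) *
          (u⁻¹ * ((u - x j) * (u - x ⟨(j : ℕ) + 1, h⟩)) *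
            ∏ a ∈ univ.filter (fun a : Fin ℓ => (j : ℕ) + 1 < (a : ℕ)), (u ^ 2 - x a ^ 2) -
          v⁻¹ * ((v - x j) * (v - x ⟨(j : ℕ) + 1, h⟩)) *
            ∏ a ∈ univ.filter (fun a : Fin ℓ => (j : ℕ) + 1 < (a : ℕ)), (v ^ 2 - x a ^ 2)) := by
      rw [← sum_range_three_esymVal h x hu, ← sum_range_three_esymVal h x hv, ← sum_Jset_eq_prod,
        huv]
      simp only [← Finset.sum_sub_distrib, ← mul_sub]
      rw [mul_assoc, Finset.sum_mul, Finset.mul_sum]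
      refine Finset.sum_congr rfl fun K1 _ => ?_
      rw [Finset.sum_mul, Finset.mul_sum]
      refine Finset.sum_congr rfl fun K2 _ => ?_
      simp only [Finset.mul_sum]
      refine Finset.sum_congr rfl fun n1 _ => Finset.sum_congr rfl fun n2 _ => ?_
      ring
    rw [key]
    rcases lt_or_ge s j with hs | hs
    · rw [hJ hs]; ring
    have hU : (u - x j) * (u - x ⟨(j : ℕ) + 1, h⟩) *
        ∏ a ∈ univ.filter (fun a : Fin ℓ => (j : ℕ) + 1 < (a : ℕ)), (u ^ 2 - x a ^ 2) = 0 := by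
      rcases hs.eq_or_lt with rfl | hs
      · simp [hus]
      rcases (Nat.succ_le_of_lt (Fin.lt_def.1 hs)).eq_or_lt with hs | hs
      · have : s = ⟨(j : ℕ) + 1, h⟩ := Fin.ext hs.symm
        simp [hus, this]
      · rw [Finset.prod_eq_zero (i := s) (by simpa using hs) (by simp [hus]), mul_zero]
    have hV : (x j - x ⟨(j : ℕ) + 1, h⟩ - zz ℓ) * ((v - x j) * (v - x ⟨(j : ℕ) + 1, h⟩) *
        ∏ a ∈ univ.filter (fun a : Fin ℓ => (j : ℕ) + 1 < (a : ℕ)), (v ^ 2 - x a ^ 2)) = 0 := by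
      have hjt : (j : ℕ) + 1 ≤ t := Nat.succ_le_of_lt (Fin.lt_def.1 (hs.trans_lt hst))
      rcases hjt.eq_or_lt with ht | ht
      · have ht' : ⟨(j : ℕ) + 1, h⟩ = t := Fin.ext ht
        rcases hε with rfl | rfl
        · simp [hvt, ht']
        · have hs' : s = j := Fin.ext (by have := Fin.lt_def.1 hst; have := Fin.le_def.1 hs; omega)
          have : x j - x t - zz ℓ = 0 := by rw [← huv, hus, hvt, hs']; ring
          rw [ht', this, zero_mul]
      · rw [Finset.prod_eq_zero (i := t) (by simpa using ht), mul_zero, mul_zero]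
        rcases hε with rfl | rfl <;> simp [hvt]
    linear_combination (zz ℓ / (u - v) * (∏ a ∈ Jset ℓ j, ((x a - u) * (x a - v)))) *
      (u⁻¹ * (x j - x ⟨(j : ℕ) + 1, h⟩ - zz ℓ) * hU - v⁻¹ * hV)
  · have hs : s < j := by
      have := Fin.lt_def.1 hst
      rw [Fin.lt_def]; omega
    have := sum_Jset_eq_prod j x u v
    rw [hJ hs, huv] at this
    rw [← mul_zero (-(x j) * (zz ℓ / (u - v) * (u ^ (-1 : ℤ) - v ^ (-1 : ℤ)))), ← this]
    simp only [Finset.mul_sum]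
    refine Finset.sum_congr rfl fun K1 _ => Finset.sum_congr rfl fun K2 _ => ?_
    ring

lemma X_sub_dvd_of_aeval_update_eq_zero {σ R : Type*} [DecidableEq σ] [CommRing R] (s : σ)
    (L P : MvPolynomial σ R) (h : aeval (Function.update X s L) P = 0) : X s - L ∣ P := by
  rw [← Ideal.mem_span_singleton, ← Ideal.Quotient.eq_zero_iff_mem]
  have : (Ideal.Quotient.mkₐ R (Ideal.span {X s - L})).comp (aeval (Function.update X s L)) =
      Ideal.Quotient.mkₐ R (Ideal.span {X s - L}) := by
    ext i
    by_cases hi : i = s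
    · subst hi
      simp only [AlgHom.comp_apply, aeval_X, Function.update_self, Ideal.Quotient.mkₐ_eq_mk]
      rw [eq_comm, Ideal.Quotient.eq]
      exact Ideal.mem_span_singleton_self _
    · simp [Function.update_of_ne hi]
  have hP := DFunLike.congr_fun this P
  rw [AlgHom.comp_apply, h, map_zero] at hP
  exact hP.symm

/-- If `φ(x_s) + ε φ(x_t)` vanishes after the substitution `x_s ↦ L`, then `x_s - L` divides it. -/
lemma X_sub_dvd_of_phiAt {B : ℤ → ℕ → Polynomial ℝ} {ℓ : ℕ} {j : Fin ℓ}
    {φ : Derivation ℝ (SS ℓ) (SS ℓ)}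
    (hx : ∀ i : Fin ℓ, algebraMap (SS ℓ) (KK ℓ) (φ (X i.castSucc)) = phi B ℓ j i)
    (s t : Fin ℓ) (ε : ℝ) {L : SS ℓ} (hL : L ≠ 0)
    (h : phiAt B ℓ (Function.update (xx ℓ) s (algebraMap (SS ℓ) (KK ℓ) L)) j s +
      algebraMap (SS ℓ) (KK ℓ) (C ε) *
        phiAt B ℓ (Function.update (xx ℓ) s (algebraMap (SS ℓ) (KK ℓ) L)) j t = 0) :
    X s.castSucc - L ∣ φ (X s.castSucc) + C ε * φ (X t.castSucc) := by
  apply X_sub_dvd_of_aeval_update_eq_zero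
  set ψ : SS ℓ →ₐ[ℝ] SS ℓ := aeval (Function.update X s.castSucc L)
  set τ : SS ℓ →+* KK ℓ := (algebraMap (SS ℓ) (KK ℓ)).comp ψ.toRingHom
  have hinj := FaithfulSMul.algebraMap_injective (SS ℓ) (KK ℓ)
  have hC : ∀ r, τ (C r) = algebraMap (SS ℓ) (KK ℓ) (C r) := fun r => by
    simp [τ, ψ, MvPolynomial.algebraMap_eq]
  have hz : τ (X (Fin.last ℓ)) = zz ℓ := by
    simp [τ, ψ, zz, Function.update_of_ne (Fin.castSucc_lt_last s).ne']
  set y := Function.update (xx ℓ) s (algebraMap (SS ℓ) (KK ℓ) L)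
  have hτ : ∀ i, τ (X i.castSucc) = y i := fun i => by
    by_cases hi : i = s
    · subst hi; simp [τ, ψ, y]
    · have : i.castSucc ≠ s.castSucc := fun h' => hi (Fin.castSucc_injective _ h')
      simp [τ, ψ, y, xx, Function.update_of_ne hi, Function.update_of_ne this]
  have hxy : ∀ i, SpecializesTo τ (xx ℓ i) (y i) := fun i => by
    rw [← hτ]; exact SpecializesTo.of_algebraMap _
  have hy : ∀ i, y i ≠ 0 := fun i => by
    by_cases hi : i = s
    · subst hi
      simpa [y] using hL
    · simp [y, Function.update_of_ne hi, xx]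
  have hphi : ∀ i, phiAt B ℓ y j i = τ (φ (X i.castSucc)) := fun i => by
    apply SpecializesTo.apply_eq (K := KK ℓ)
    rw [hx, phi_eq_phiAt]
    exact SpecializesTo.phiAt hC hz hxy hy j i
  rw [hphi, hphi, ← hC, ← map_mul, ← map_add] at h
  exact (map_eq_zero_iff _ hinj).1 h

/-- Let `ℓ ≥ 2`.  For every `1 ≤ j ≤ ℓ`, the derivation `φ_j` belongs to
`D(cS(D_ℓ))`: for every defining linear form `α` of the cone over the Shi
arrangement of type `D_ℓ`, `α` divides `φ_j(α)` in `S`.  (Formally: for any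
`ℝ`-derivation `φ` of `S` with `φ(z) = 0` whose values on the variables are the
`φ_j(x_i)`, every defining form `α` divides `φ(α)`.) -/
theorem phi_mem_D (B : ℤ → ℕ → Polynomial ℝ) (hB : BProp B)
    (ℓ : ℕ) (hℓ : 2 ≤ ℓ) (j : Fin ℓ)
    (φ : Derivation ℝ (SS ℓ) (SS ℓ))
    (hz : φ (X (Fin.last ℓ)) = 0)
    (hx : ∀ i : Fin ℓ, algebraMap (SS ℓ) (KK ℓ) (φ (X i.castSucc)) = phi B ℓ j i) :
    ∀ α ∈ forms ℓ, α ∣ φ α := by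
  rintro α (rfl | ⟨s, t, ε, hst, hε, hα⟩)
  · simp [hz]
  have hinj := FaithfulSMul.algebraMap_injective (SS ℓ) (KK ℓ)
  have hCε : (C ε : SS ℓ) = 1 ∨ (C ε : SS ℓ) = -1 := by rcases hε with rfl | rfl <;> simp
  have hts : t ≠ s := hst.ne'
  have hφC : φ (C ε) = 0 := by rw [← MvPolynomial.algebraMap_eq, Derivation.map_algebraMap]
  rcases hα with rfl | rfl
  · have hφ : φ (X s.castSucc + C ε * X t.castSucc - X (Fin.last ℓ)) =
        φ (X s.castSucc) + C ε * φ (X t.castSucc) := by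
      simp [Derivation.leibniz, hz, hφC]
    have hne : ∀ c : ℝ, (X (Fin.last ℓ) - C c * X t.castSucc : SS ℓ) ≠ 0 := fun c h0 => by
      have := congrArg (MvPolynomial.eval (Pi.single (Fin.last ℓ) (1 : ℝ))) h0
      simp [(Fin.castSucc_lt_last t).ne] at this
    rw [hφ, show (X s.castSucc + C ε * X t.castSucc - X (Fin.last ℓ) : SS ℓ) =
      X s.castSucc - (X (Fin.last ℓ) - C ε * X t.castSucc) by ring]
    refine X_sub_dvd_of_phiAt hx s t ε (hne ε) ?_
    set y := Function.update (xx ℓ) s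
      (algebraMap (SS ℓ) (KK ℓ) (X (Fin.last ℓ) - C ε * X t.castSucc)) with hy
    have hys : y s = zz ℓ - algebraMap (SS ℓ) (KK ℓ) (C ε) * xx ℓ t := by
      simp [hy, zz, xx]
    have hyt : y t = xx ℓ t := by simp [hy, Function.update_of_ne hts]
    have hxt : xx ℓ t ≠ 0 := by simp [xx]
    have hε' : algebraMap (SS ℓ) (KK ℓ) (C ε) = 1 ∨ algebraMap (SS ℓ) (KK ℓ) (C ε) = -1 := by
      rcases hCε with h | h <;> simp [h]
    have hu : y s ≠ 0 := by
      rw [hy, Function.update_self, Ne, map_eq_zero_iff _ hinj]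
      exact hne ε
    have huv : y s - algebraMap (SS ℓ) (KK ℓ) (C ε) * y t ≠ 0 := by
      have : y s - algebraMap (SS ℓ) (KK ℓ) (C ε) * y t =
          algebraMap (SS ℓ) (KK ℓ) (X (Fin.last ℓ) - C (2 * ε) * X t.castSucc) := by
        rw [hys, hyt]
        simp only [zz, xx, map_sub, map_mul, map_ofNat]
        ring
      rw [this, Ne, map_eq_zero_iff _ hinj]
      exact hne _
    have hsum : y s + algebraMap (SS ℓ) (KK ℓ) (C ε) * y t = zz ℓ := by rw [hys, hyt]; ring
    have hv : algebraMap (SS ℓ) (KK ℓ) (C ε) * y t ≠ 0 := by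
      rw [hyt]
      rcases hε' with h | h <;> simp [h, hxt]
    rw [← phiWith_eq_zero (j := j) hst hε' rfl rfl hsum hu hv, phiAt, phiAt]
    rcases hε' with h | h
    · simp only [h, one_mul] at hsum hv huv ⊢
      rw [phiWith_add]
      exact phiWith_congr fun p q hp => arB_add_arB hB ℓ hp q hsum hu hv huv
    · simp only [h, neg_one_mul] at hsum hv huv ⊢
      rw [phiWith_neg, phiWith_add]
      refine phiWith_congr fun p q hp => ?_
      rw [← arB_neg hB ℓ hp]
      exact arB_add_arB hB ℓ hp q hsum hu hv huv
  · have hφ : φ (X s.castSucc + C ε * X t.castSucc) =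
        φ (X s.castSucc) + C ε * φ (X t.castSucc) := by
      simp [Derivation.leibniz, hφC]
    rw [hφ, show (X s.castSucc + C ε * X t.castSucc : SS ℓ) =
      X s.castSucc - (-(C ε * X t.castSucc)) by ring]
    refine X_sub_dvd_of_phiAt hx s t ε (by rcases hCε with h | h <;> simp [h]) ?_
    set y := Function.update (xx ℓ) s
      (algebraMap (SS ℓ) (KK ℓ) (-(C ε * X t.castSucc))) with hy
    have hys : y s = -(algebraMap (SS ℓ) (KK ℓ) (C ε) * y t) := by
      simp [hy, xx, Function.update_of_ne hts]
    rw [phiAt, phiAt, hys]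
    rcases hCε with h | h
    · simp only [h, map_one, one_mul]
      rw [phiWith_congr fun p q hp => arB_neg hB ℓ hp q (y t), ← phiWith_neg, neg_add_cancel]
    · simp only [h, map_neg, map_one, neg_one_mul, neg_neg, add_neg_cancel]

end
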